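/- (Corollary, Haar-averaged operator purity / Page curve for local-operator entanglement.) Let N ≥ 2, N = N_A + N_B, D = 2^N, D_A = 2^{N_A}, let O = P_{a₀} be a non-identity Pauli string on (Fin N → Fin 2), and let μ be a regular left-invariant Borel probability measure on the compact group Matrix.unitaryGroup (Fin N → Fin 2) ℂ (the normalized Haar measure). Then ∫ Re tr(ρ_A(Uᴴ * O * U)²) dμ(U) = ((D_A⁴ + D²)·(D² − 10) − D_A²·(D² − 19)) / (D_A²·(D² − 9)·(D² − 1)). -/

import Mathlib

open Matrix Kronecker
open scoped Classical

noncomputable section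

/-- Single-qubit Pauli matrices. -/
def pauli : Fin 4 → Matrix (Fin 2) (Fin 2) ℂ :=
  ![1, !![0, 1; 1, 0], !![0, -Complex.I; Complex.I, 0], !![1, 0; 0, -1]]

/-- Pauli string on `N` qubits with label `a`. -/
def PauliString {N : ℕ} (a : Fin N → Fin 4) :
    Matrix (Fin N → Fin 2) (Fin N → Fin 2) ℂ :=
  fun f g => ∏ k, pauli (a k) (f k) (g k)

/-- Reduced Choi state: partial trace over the doubled-B factor of the
normalized Choi state of `O`. -/
def rhoA {ιA ιB : Type*} [Fintype ιA] [Fintype ιB]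
    (O : Matrix (ιA × ιB) (ιA × ιB) ℂ) :
    Matrix (ιA × ιA) (ιA × ιA) ℂ :=
  fun p q =>
    (1 / (Fintype.card ιA * Fintype.card ιB : ℂ)) *
      ∑ b : ιB, ∑ b' : ιB, O (p.1, b) (p.2, b') * star (O (q.1, b) (q.2, b'))

/-- Identification of `N = N_A + N_B` qubits with the pair of subsystems. -/
def qubitEquiv (NA NB : ℕ) :
    (Fin (NA + NB) → Fin 2) ≃ (Fin NA → Fin 2) × (Fin NB → Fin 2) :=
  (Equiv.arrowCongr finSumFinEquiv.symm (Equiv.refl (Fin 2))).trans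
    (Equiv.sumArrowEquivProdArrow _ _ _)

/-- Reduced Choi state of an `N = N_A + N_B` qubit operator, subsystem A
being the first `N_A` qubits. -/
def rhoAq (NA NB : ℕ)
    (O : Matrix (Fin (NA + NB) → Fin 2) (Fin (NA + NB) → Fin 2) ℂ) :
    Matrix ((Fin NA → Fin 2) × (Fin NA → Fin 2))
      ((Fin NA → Fin 2) × (Fin NA → Fin 2)) ℂ :=
  rhoA (Matrix.reindex (qubitEquiv NA NB) (qubitEquiv NA NB) O)

/-- `n`-fold replica (tensor power) of a matrix. -/
def replica {ι : Type*} (n : ℕ) (O : Matrix ι ι ℂ) :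
    Matrix (Fin n → ι) (Fin n → ι) ℂ :=
  fun f g => ∏ a, O (f a) (g a)

/-- Replica permutation operator. -/
def Tperm {ι : Type*} [DecidableEq ι] {n : ℕ} (π : Equiv.Perm (Fin n)) :
    Matrix (Fin n → ι) (Fin n → ι) ℂ :=
  fun f g => if f = g ∘ π then 1 else 0

/-- Number of cycles of a permutation, counting fixed points as 1-cycles. -/
def numCycles {n : ℕ} (π : Equiv.Perm (Fin n)) : ℕ :=
  Multiset.card π.cycleType + (Finset.univ.filter fun x => π x = x).card

/-- `δ(π) = 0` if `π` has no fixed points and all cycles of even length,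
else `δ(π) = 1`. -/
def deltaOdd {n : ℕ} (π : Equiv.Perm (Fin n)) : ℕ :=
  if (∀ x, π x ≠ x) ∧ (∀ c ∈ π.cycleType, Even c) then 0 else 1

/-- Projector onto four-fold replicated Pauli strings. -/
def LambdaPlus (N : ℕ) :
    Matrix (Fin 4 → (Fin N → Fin 2)) (Fin 4 → (Fin N → Fin 2)) ℂ :=
  (1 / (4 ^ N : ℂ)) • ∑ a : Fin N → Fin 4, replica 4 (PauliString a)

def permA : Equiv.Perm (Fin 4) := Equiv.swap 0 1 * Equiv.swap 2 3
def permB : Equiv.Perm (Fin 4) := Equiv.swap 0 3 * Equiv.swap 1 2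

/-- The purity contraction permutation operator `T'` on four replicas of a
bipartite system. -/
def Tprime {ιA ιB : Type*} [DecidableEq ιA] [DecidableEq ιB] :
    Matrix (Fin 4 → ιA × ιB) (Fin 4 → ιA × ιB) ℂ :=
  fun f g =>
    if (∀ a, (f a).1 = (g (permA a)).1 ∧ (f a).2 = (g (permB a)).2) then 1 else 0

/-- The unitary stabilizer group of `U` (as a finite set of pairs of Pauli
labels). -/
def Stab {N : ℕ} (U : Matrix (Fin N → Fin 2) (Fin N → Fin 2) ℂ) :
    Finset ((Fin N → Fin 4) × (Fin N → Fin 4)) :=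
  Finset.univ.filter fun p =>
    Matrix.trace (PauliString p.1 * Uᴴ * PauliString p.2 * U) / (2 ^ N : ℂ)
      ∈ ({1, -1} : Set ℂ)

open MeasureTheory

section Unitary

variable {ι : Type*} [Fintype ι] [DecidableEq ι]

instance Matrix.unitaryGroup.instCompactSpace : CompactSpace (Matrix.unitaryGroup ι ℂ) := by
  refine isCompact_iff_compactSpace.mp ?_
  refine IsCompact.of_isClosed_subset
    (isCompact_univ_pi fun _ : ι => isCompact_univ_pi fun _ : ι =>
      isCompact_closedBall (0 : ℂ) 1) isClosed_unitary ?_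
  intro U hU i _ j _
  simpa using entry_norm_bound_of_unitary hU i j

/-- The operator `O` evolved in the Heisenberg picture by `U`. -/
def heisenberg (O : Matrix ι ι ℂ) (U : Matrix.unitaryGroup ι ℂ) : Matrix ι ι ℂ :=
  (U : Matrix ι ι ℂ)ᴴ * O * (U : Matrix ι ι ℂ)

@[fun_prop]
theorem continuous_heisenberg (O : Matrix ι ι ℂ) : Continuous (heisenberg O) := by
  unfold heisenberg
  fun_prop

@[fun_prop]
theorem continuous_heisenberg_apply (O : Matrix ι ι ℂ) (i j : ι) :
    Continuous fun U => heisenberg O U i j :=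
  (continuous_heisenberg O).matrix_elem i j

theorem heisenberg_mul (O : Matrix ι ι ℂ) (U V : Matrix.unitaryGroup ι ℂ) :
    heisenberg O (U * V) = (V : Matrix ι ι ℂ)ᴴ * heisenberg O U * (V : Matrix ι ι ℂ) := by
  simp [heisenberg, Matrix.mul_assoc]

theorem heisenberg_mul_self {O : Matrix ι ι ℂ} (hO : O * O = 1) (U : Matrix.unitaryGroup ι ℂ) :
    heisenberg O U * heisenberg O U = 1 := by
  have hU : (U : Matrix ι ι ℂ) * (U : Matrix ι ι ℂ)ᴴ = 1 := U.2.2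
  have hU' : (U : Matrix ι ι ℂ)ᴴ * (U : Matrix ι ι ℂ) = 1 := U.2.1
  calc _ = (U : Matrix ι ι ℂ)ᴴ * O * ((U : Matrix ι ι ℂ) * (U : Matrix ι ι ℂ)ᴴ) * O * U := by
        simp only [heisenberg, Matrix.mul_assoc]
    _ = 1 := by rw [hU, Matrix.mul_one, Matrix.mul_assoc _ O O, hO, Matrix.mul_one, hU']

theorem trace_heisenberg (O : Matrix ι ι ℂ) (U : Matrix.unitaryGroup ι ℂ) :
    (heisenberg O U).trace = O.trace := by
  have hU : (U : Matrix ι ι ℂ) * (U : Matrix ι ι ℂ)ᴴ = 1 := U.2.2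
  rw [heisenberg, Matrix.trace_mul_comm, ← Matrix.mul_assoc, hU, Matrix.one_mul]

theorem isHermitian_heisenberg {O : Matrix ι ι ℂ} (hO : O.IsHermitian)
    (U : Matrix.unitaryGroup ι ℂ) : (heisenberg O U).IsHermitian :=
  Matrix.isHermitian_conjTranspose_mul_mul _ hO

theorem infinite_norm_one_add_eq_one : {z : ℂ | ‖1 + z‖ = 1}.Infinite := by
  have h : (Metric.sphere (-1 : ℂ) 1).Infinite :=
    (isPreconnected_sphere (by simp [Complex.rank_real_complex]) _ _).infinite_of_nontrivial
      ⟨0, by simp, -2, by norm_num, by norm_num⟩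
  refine h.mono fun z hz => ?_
  simpa [dist_eq_norm, add_comm] using hz

theorem one_add_smul_mem_unitaryGroup {P : Matrix ι ι ℂ} (hP : P.IsHermitian) (hPP : P * P = P)
    {z : ℂ} (hz : ‖1 + z‖ = 1) : 1 + z • P ∈ Matrix.unitaryGroup ι ℂ := by
  have h : z + star z + z * star z = 0 := by
    have := Complex.mul_conj (1 + z)
    rw [Complex.normSq_eq_norm_sq, hz] at this
    simp only [map_add, map_one, Complex.ofReal_one, one_pow] at this
    simp only [Complex.star_def]
    linear_combination this
  rw [Matrix.mem_unitaryGroup_iff, Matrix.star_eq_conjTranspose, Matrix.conjTranspose_add,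
    Matrix.conjTranspose_one, Matrix.conjTranspose_smul, hP.eq]
  simp only [add_mul, mul_add, Matrix.one_mul, Matrix.mul_one, Matrix.smul_mul, Matrix.mul_smul,
    hPP]
  rw [smul_smul]
  calc _ = 1 + (z + star z + z * star z) • P := by simp only [add_smul]; module
    _ = 1 := by rw [h]; simp

open scoped ComplexOrder in
/-- A linear functional vanishing on the self-adjoint idempotents vanishes. -/
theorem LinearMap.eq_zero_of_forall_isHermitian_idempotent (L : Matrix ι ι ℂ →ₗ[ℂ] ℂ)
    (hL : ∀ P : Matrix ι ι ℂ, P.IsHermitian → P * P = P → L P = 0) : L = 0 := by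
  have hv : ∀ v : ι → ℂ, L (vecMulVec v (star v)) = 0 := by
    intro v
    by_cases h0 : v = 0
    · simp [h0]
    have hs : star v ⬝ᵥ v ≠ 0 := by rwa [Ne, dotProduct_star_self_eq_zero]
    have hstar : star (star v ⬝ᵥ v) = star v ⬝ᵥ v := by
      simp [dotProduct, mul_comm]
    have := hL ((star v ⬝ᵥ v)⁻¹ • vecMulVec v (star v))
      (by
        rw [Matrix.IsHermitian, conjTranspose_smul, conjTranspose_vecMulVec, star_inv₀, hstar,
          star_star])
      (by
        rw [Matrix.smul_mul, Matrix.mul_smul, vecMulVec_mul_vecMulVec, vecMulVec_smul, smul_smul,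
          smul_smul, mul_assoc, inv_mul_cancel₀ hs, mul_one])
    rw [map_smul, smul_eq_mul] at this
    exact (mul_eq_zero.mp this).resolve_left (inv_ne_zero hs)
  refine Matrix.ext_linearMap _ fun i j => LinearMap.ext_ring ?_
  set u : ι → ℂ := Pi.single i 1 with hu
  set w : ι → ℂ := Pi.single j 1 with hw
  have hsingle : Matrix.single i j (1 : ℂ) = vecMulVec u (star w) := by
    ext a b
    simp [hu, hw, vecMulVec_apply, Matrix.single_apply, Pi.single_apply, ← ite_and,
      and_comm, eq_comm]
  have hpol : vecMulVec u (star w) = (1 / 4 : ℂ) • (vecMulVec (u + w) (star (u + w)) -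
      vecMulVec (u - w) (star (u - w)) +
      Complex.I • vecMulVec (u + Complex.I • w) (star (u + Complex.I • w)) -
      Complex.I • vecMulVec (u - Complex.I • w) (star (u - Complex.I • w))) := by
    ext a b
    simp only [vecMulVec_apply, Matrix.smul_apply, Matrix.sub_apply, Matrix.add_apply, Pi.add_apply,
      Pi.sub_apply, Pi.smul_apply, Pi.star_apply, smul_eq_mul, star_add, star_sub, star_mul',
      Complex.star_def, Complex.conj_I]
    ring_nf
    simp only [Complex.I_sq]
    ring
  simp only [LinearMap.comp_apply, Matrix.singleLinearMap_apply, hsingle, hpol, map_smul, map_add,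
    map_sub, hv]
  simp

end Unitary

section HaarTwirl

variable {ι : Type*} [Fintype ι] [DecidableEq ι]
  [MeasurableSpace (Matrix.unitaryGroup ι ℂ)] [BorelSpace (Matrix.unitaryGroup ι ℂ)]
  (μ : Measure (Matrix.unitaryGroup ι ℂ))

/-- The expectation of `∏ k, (x k + z * y k)` as a polynomial in `z`. -/
def prodAddPoly {n : ℕ} (x y : Fin n → Matrix.unitaryGroup ι ℂ → ℂ) : Polynomial ℂ :=
  ∑ t : Finset (Fin n), Polynomial.C (∫ U, (∏ k ∈ t, y k U) * ∏ k ∈ tᶜ, x k U ∂μ) *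
    Polynomial.X ^ t.card

omit [BorelSpace (Matrix.unitaryGroup ι ℂ)] in
theorem coeff_one_prodAddPoly {n : ℕ} (x y : Fin n → Matrix.unitaryGroup ι ℂ → ℂ) :
    (prodAddPoly μ x y).coeff 1 = ∑ k, ∫ U, y k U * ∏ l ∈ {k}ᶜ, x l U ∂μ := by
  have h : (prodAddPoly μ x y).coeff 1 =
      ∑ t ∈ Finset.powersetCard 1 (Finset.univ : Finset (Fin n)),
        ∫ U, (∏ k ∈ t, y k U) * ∏ k ∈ tᶜ, x k U ∂μ := by
    simp only [prodAddPoly, Polynomial.finsetSum_coeff, Polynomial.coeff_C_mul,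
      Polynomial.coeff_X_pow, mul_ite, mul_one, mul_zero]
    rw [← Finset.sum_filter]
    refine Finset.sum_congr ?_ fun _ _ => rfl
    ext t
    simp [Finset.mem_powersetCard, eq_comm]
  rw [h, Finset.powersetCard_one, Finset.sum_map]
  simp

variable [IsProbabilityMeasure μ]

variable {μ} in
theorem integrable_unitaryGroup_of_continuous {f : Matrix.unitaryGroup ι ℂ → ℂ}
    (hf : Continuous f) : Integrable f μ :=
  hf.integrable_of_hasCompactSupport (HasCompactSupport.of_compactSpace f)

theorem eval_prodAddPoly {n : ℕ} {x y : Fin n → Matrix.unitaryGroup ι ℂ → ℂ}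
    (hx : ∀ k, Continuous (x k)) (hy : ∀ k, Continuous (y k)) (z : ℂ) :
    (prodAddPoly μ x y).eval z = ∫ U, ∏ k, (x k U + z * y k U) ∂μ := by
  have h : ∀ U, ∏ k, (x k U + z * y k U) =
      ∑ t : Finset (Fin n), (∏ k ∈ t, y k U) * (∏ k ∈ tᶜ, x k U) * z ^ t.card := by
    intro U
    simp_rw [add_comm (x _ U)]
    rw [Finset.prod_add, Finset.powerset_univ]
    refine Finset.sum_congr rfl fun t _ => ?_
    rw [Finset.prod_mul_distrib, Finset.prod_const, ← Finset.compl_eq_univ_sdiff]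
    ring
  simp_rw [h]
  rw [integral_finsetSum _ fun t _ => integrable_unitaryGroup_of_continuous (by fun_prop)]
  simp [prodAddPoly, Polynomial.eval_finsetSum, integral_mul_const]

variable [μ.IsMulLeftInvariant]

theorem isMulRightInvariant_of_isProbabilityMeasure_unitaryGroup : μ.IsMulRightInvariant := by
  have : μ.IsHaarMeasure :=
    Measure.isHaarMeasure_of_isCompact_nonempty_interior μ Set.univ isCompact_univ (by simp)
      (by simp) (by simp)
  refine ⟨fun g => ?_⟩
  have : IsProbabilityMeasure (μ.map (· * g)) :=
    Measure.isProbabilityMeasure_map (measurable_mul_const g).aemeasurable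
  have : (μ.map (· * g)).IsHaarMeasure :=
    Measure.isHaarMeasure_of_isCompact_nonempty_interior _ Set.univ isCompact_univ (by simp)
      (by simp) (by simp)
  exact Measure.isHaarMeasure_eq_of_isProbabilityMeasure _ _

/-- Invariance of the law of the evolved operator under conjugation. -/
theorem integral_prod_unitary_mul (O : Matrix ι ι ℂ) {n : ℕ} (p q : Fin n → ι)
    {V : Matrix ι ι ℂ} (hV : V ∈ Matrix.unitaryGroup ι ℂ) :
    ∫ U, ∏ k, (V * heisenberg O U) (p k) (q k) ∂μ =
      ∫ U, ∏ k, (heisenberg O U * V) (p k) (q k) ∂μ := by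
  have := isMulRightInvariant_of_isProbabilityMeasure_unitaryGroup μ
  rw [← integral_mul_right_eq_self (μ := μ) _ (⟨V, hV⟩ : Matrix.unitaryGroup ι ℂ)]
  have h : V * Vᴴ = 1 := hV.2
  simp only [heisenberg_mul, ← Matrix.mul_assoc, h, Matrix.one_mul]

/-- The sum over the replicas of the moments of `O` with one factor replaced by its commutator
with `H`. -/
def momentCommutator (O : Matrix ι ι ℂ) {n : ℕ} (p q : Fin n → ι) : Matrix ι ι ℂ →ₗ[ℂ] ℂ where
  toFun H := ∑ k, ∫ U, (heisenberg O U * H - H * heisenberg O U) (p k) (q k) *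
    ∏ l ∈ {k}ᶜ, heisenberg O U (p l) (q l) ∂μ
  map_add' H K := by
    rw [← Finset.sum_add_distrib]
    refine Finset.sum_congr rfl fun k _ => ?_
    rw [← integral_add (integrable_unitaryGroup_of_continuous (by fun_prop))
      (integrable_unitaryGroup_of_continuous (by fun_prop))]
    congr! 2 with U
    simp only [Matrix.mul_add, Matrix.add_mul, Matrix.sub_apply, Matrix.add_apply]
    ring
  map_smul' c H := by
    rw [Finset.smul_sum]
    refine Finset.sum_congr rfl fun k _ => ?_
    rw [← integral_smul]
    congr! 2 with U
    simp only [Matrix.mul_smul, Matrix.smul_mul, Matrix.sub_apply, Matrix.smul_apply, smul_eq_mul,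
      RingHom.id_apply]
    ring

omit [μ.IsMulLeftInvariant] in
theorem momentCommutator_apply (O : Matrix ι ι ℂ) {n : ℕ} (p q : Fin n → ι) (H : Matrix ι ι ℂ) :
    momentCommutator μ O p q H = ∑ k, ∫ U, (heisenberg O U * H - H * heisenberg O U) (p k) (q k) *
      ∏ l ∈ {k}ᶜ, heisenberg O U (p l) (q l) ∂μ :=
  rfl

theorem momentCommutator_eq_zero (O : Matrix ι ι ℂ) {n : ℕ} (p q : Fin n → ι) :
    momentCommutator μ O p q = 0 := by
  refine LinearMap.eq_zero_of_forall_isHermitian_idempotent _ fun P hP hPP => ?_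
  have hpoly : prodAddPoly μ (fun k U => heisenberg O U (p k) (q k))
        (fun k U => (heisenberg O U * P) (p k) (q k)) =
      prodAddPoly μ (fun k U => heisenberg O U (p k) (q k))
        (fun k U => (P * heisenberg O U) (p k) (q k)) := by
    refine Polynomial.eq_of_infinite_eval_eq _ _ (infinite_norm_one_add_eq_one.mono fun z hz => ?_)
    have := integral_prod_unitary_mul μ O p q (one_add_smul_mem_unitaryGroup hP hPP hz)
    simp only [add_mul, mul_add, Matrix.one_mul, Matrix.mul_one, Matrix.smul_mul, Matrix.mul_smul,
      Matrix.add_apply, Matrix.smul_apply, smul_eq_mul] at this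
    rw [Set.mem_ofPred_eq, eval_prodAddPoly μ (fun k => by fun_prop) (fun k => by fun_prop),
      eval_prodAddPoly μ (fun k => by fun_prop) (fun k => by fun_prop), this]
  have h := congrArg (Polynomial.coeff · 1) hpoly
  simp only [coeff_one_prodAddPoly] at h
  rw [← sub_eq_zero, ← Finset.sum_sub_distrib] at h
  rw [← h, momentCommutator_apply]
  refine Finset.sum_congr rfl fun k _ => ?_
  rw [← integral_sub (integrable_unitaryGroup_of_continuous (by fun_prop))
      (integrable_unitaryGroup_of_continuous (by fun_prop))]
  simp only [Matrix.sub_apply, sub_mul]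

section CommutatorSingle

omit [MeasurableSpace (Matrix.unitaryGroup ι ℂ)] [BorelSpace (Matrix.unitaryGroup ι ℂ)]

/-- The commutator of a matrix with a matrix unit. -/
def commutatorSingle (x : Matrix ι ι ℂ) (i c : ι) : Matrix ι ι ℂ :=
  x * Matrix.single i c 1 - Matrix.single i c 1 * x

theorem commutatorSingle_apply (x : Matrix ι ι ℂ) (i c a b : ι) :
    commutatorSingle x i c a b =
      x a i * (1 : Matrix ι ι ℂ) c b - (1 : Matrix ι ι ℂ) a i * x c b := by
  simp [commutatorSingle, Matrix.mul_apply, Matrix.single_apply, Matrix.one_apply, ite_and, eq_comm]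

@[fun_prop]
theorem continuous_commutatorSingle_heisenberg_apply (O : Matrix ι ι ℂ) (i c a b : ι) :
    Continuous fun U => commutatorSingle (heisenberg O U) i c a b := by
  simp only [commutatorSingle_apply]
  fun_prop

theorem sum_commutatorSingle_mul (x : Matrix ι ι ℂ) (a i : ι) (r : ℂ) :
    ∑ c, commutatorSingle x i c a c * r =
      Fintype.card ι * (x a i * r) - (1 : Matrix ι ι ℂ) a i * x.trace * r := by
  simp only [commutatorSingle_apply, sub_mul, Finset.sum_sub_distrib, ← Finset.sum_mul,
    ← Finset.mul_sum, Matrix.trace, Matrix.diag_apply, Matrix.one_apply_eq]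
  simp
  ring

theorem sum_commutatorSingle_mul_mul (x : Matrix ι ι ℂ) (a b i j : ι) (r : ℂ) :
    ∑ c, commutatorSingle x i c a b * (x j c * r) =
      x j b * x a i * r - (1 : Matrix ι ι ℂ) a i * (x * x) j b * r := by
  have h : ∀ c, commutatorSingle x i c a b * (x j c * r) =
      x j c * (1 : Matrix ι ι ℂ) c b * (x a i * r) -
        (x j c * x c b) * ((1 : Matrix ι ι ℂ) a i * r) := by
    intro c
    rw [commutatorSingle_apply]
    ring
  simp only [h, Finset.sum_sub_distrib, ← Finset.sum_mul, ← Matrix.mul_apply, Matrix.mul_one]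
  ring

end CommutatorSingle

/-- The joint moments of the matrix entries of the evolved operator. -/
def heisenbergMoment (O : Matrix ι ι ℂ) {n : ℕ} (p q : Fin n → ι) : ℂ :=
  ∫ U, ∏ k, heisenberg O U (p k) (q k) ∂μ

theorem integral_sum_commutatorSingle (O : Matrix ι ι ℂ) {n : ℕ} (p q : Fin (n + 1) → ι) :
    ∫ U, ∑ k, ∑ c, commutatorSingle (heisenberg O U) (q 0) c (p k) (Function.update q 0 c k) *
      ∏ l ∈ {k}ᶜ, heisenberg O U (p l) (Function.update q 0 c l) ∂μ = 0 := by
  have h : ∀ c, ∑ k, ∫ U,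
      commutatorSingle (heisenberg O U) (q 0) c (p k) (Function.update q 0 c k) *
        ∏ l ∈ {k}ᶜ, heisenberg O U (p l) (Function.update q 0 c l) ∂μ = 0 := fun c => by
    exact (momentCommutator_apply μ O p (Function.update q 0 c) (Matrix.single (q 0) c 1)).symm.trans
      (by rw [momentCommutator_eq_zero, LinearMap.zero_apply])
  rw [integral_finsetSum _ fun k _ => integrable_unitaryGroup_of_continuous (by fun_prop)]
  refine (Finset.sum_congr rfl fun k _ => integral_finsetSum _ fun c _ =>
    integrable_unitaryGroup_of_continuous (by fun_prop)).trans ?_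
  rw [Finset.sum_comm]
  exact Finset.sum_eq_zero fun c _ => h c

variable {O : Matrix ι ι ℂ} (hOO : O * O = 1) (hO : O.trace = 0)
include hOO hO

theorem heisenbergMoment_two_recursion (p q : Fin 2 → ι) :
    Fintype.card ι * heisenbergMoment μ O p q + heisenbergMoment μ O p (q ∘ Equiv.swap 0 1) =
      (1 : Matrix ι ι ℂ) (p 0) (q 1) * (1 : Matrix ι ι ℂ) (p 1) (q 0) := by
  have h := integral_sum_commutatorSingle μ O p q
  have hpt : ∀ U, ∑ k, ∑ c,
      commutatorSingle (heisenberg O U) (q 0) c (p k) (Function.update q 0 c k) *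
        ∏ l ∈ {k}ᶜ, heisenberg O U (p l) (Function.update q 0 c l) =
      Fintype.card ι * ∏ k, heisenberg O U (p k) (q k) +
      ∏ k, heisenberg O U (p k) ((q ∘ Equiv.swap 0 1) k) -
      (1 : Matrix ι ι ℂ) (p 0) (q 1) * (1 : Matrix ι ι ℂ) (p 1) (q 0) := by
    intro U
    have h0 : ({0}ᶜ : Finset (Fin 2)) = {1} := by decide
    have h1 : ({1}ᶜ : Finset (Fin 2)) = {0} := by decide
    have e0 := sum_commutatorSingle_mul (heisenberg O U) (p 0) (q 0) (heisenberg O U (p 1) (q 1))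
    have e1 := sum_commutatorSingle_mul_mul (heisenberg O U) (p 1) (q 1) (q 0) (p 0) 1
    rw [trace_heisenberg, hO] at e0
    rw [heisenberg_mul_self hOO] at e1
    simp only [mul_one] at e1
    simp [Fin.sum_univ_two, Fin.prod_univ_two, h0, h1, e0, e1]
    ring
  simp_rw [hpt] at h
  rw [integral_sub (integrable_unitaryGroup_of_continuous (by fun_prop)) (integrable_const _),
    integral_add (integrable_unitaryGroup_of_continuous (by fun_prop))
      (integrable_unitaryGroup_of_continuous (by fun_prop)), integral_const_mul] at h
  simp only [integral_const, probReal_univ, one_smul] at h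
  exact sub_eq_zero.mp h

theorem heisenbergMoment_four_recursion (p q : Fin 4 → ι) :
    Fintype.card ι * heisenbergMoment μ O p q + heisenbergMoment μ O p (q ∘ Equiv.swap 0 1) +
      heisenbergMoment μ O p (q ∘ Equiv.swap 0 2) + heisenbergMoment μ O p (q ∘ Equiv.swap 0 3) =
      (1 : Matrix ι ι ℂ) (p 0) (q 1) * (1 : Matrix ι ι ℂ) (p 1) (q 0) *
        heisenbergMoment μ O ![p 2, p 3] ![q 2, q 3] +
      (1 : Matrix ι ι ℂ) (p 0) (q 2) * (1 : Matrix ι ι ℂ) (p 2) (q 0) *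
        heisenbergMoment μ O ![p 1, p 3] ![q 1, q 3] +
      (1 : Matrix ι ι ℂ) (p 0) (q 3) * (1 : Matrix ι ι ℂ) (p 3) (q 0) *
        heisenbergMoment μ O ![p 1, p 2] ![q 1, q 2] := by
  have h := integral_sum_commutatorSingle μ O p q
  have hpt : ∀ U, ∑ k, ∑ c,
      commutatorSingle (heisenberg O U) (q 0) c (p k) (Function.update q 0 c k) *
        ∏ l ∈ {k}ᶜ, heisenberg O U (p l) (Function.update q 0 c l) =
      Fintype.card ι * ∏ k, heisenberg O U (p k) (q k) +
      ∏ k, heisenberg O U (p k) ((q ∘ Equiv.swap 0 1) k) +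
      ∏ k, heisenberg O U (p k) ((q ∘ Equiv.swap 0 2) k) +
      ∏ k, heisenberg O U (p k) ((q ∘ Equiv.swap 0 3) k) -
      ((1 : Matrix ι ι ℂ) (p 0) (q 1) * (1 : Matrix ι ι ℂ) (p 1) (q 0) *
        (∏ k, heisenberg O U (![p 2, p 3] k) (![q 2, q 3] k)) +
      (1 : Matrix ι ι ℂ) (p 0) (q 2) * (1 : Matrix ι ι ℂ) (p 2) (q 0) *
        (∏ k, heisenberg O U (![p 1, p 3] k) (![q 1, q 3] k)) +
      (1 : Matrix ι ι ℂ) (p 0) (q 3) * (1 : Matrix ι ι ℂ) (p 3) (q 0) *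
        ∏ k, heisenberg O U (![p 1, p 2] k) (![q 1, q 2] k)) := by
    intro U
    have h0 : ({0}ᶜ : Finset (Fin 4)) = {1, 2, 3} := by decide
    have h1 : ({1}ᶜ : Finset (Fin 4)) = {0, 2, 3} := by decide
    have h2 : ({2}ᶜ : Finset (Fin 4)) = {0, 1, 3} := by decide
    have h3 : ({3}ᶜ : Finset (Fin 4)) = {0, 1, 2} := by decide
    have hs12 : (Equiv.swap (0 : Fin 4) 1) 2 = 2 := by decide
    have hs13 : (Equiv.swap (0 : Fin 4) 1) 3 = 3 := by decide
    have hs21 : (Equiv.swap (0 : Fin 4) 2) 1 = 1 := by decide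
    have hs23 : (Equiv.swap (0 : Fin 4) 2) 3 = 3 := by decide
    have hs31 : (Equiv.swap (0 : Fin 4) 3) 1 = 1 := by decide
    have hs32 : (Equiv.swap (0 : Fin 4) 3) 2 = 2 := by decide
    have e0 := fun r => sum_commutatorSingle_mul (heisenberg O U) (p 0) (q 0) r
    have e := fun a b r => sum_commutatorSingle_mul_mul (heisenberg O U) a b (q 0) (p 0) r
    rw [trace_heisenberg, hO] at e0
    rw [heisenberg_mul_self hOO] at e
    simp [Fin.sum_univ_four, Fin.prod_univ_four, h0, h1, h2, h3, e0, e, hs12, hs13, hs21, hs23,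
      hs31, hs32]
    ring
  simp_rw [hpt] at h
  rw [integral_sub (integrable_unitaryGroup_of_continuous (by fun_prop))
      (integrable_unitaryGroup_of_continuous (by fun_prop))] at h
  iterate 5 rw [integral_add (integrable_unitaryGroup_of_continuous (by fun_prop))
      (integrable_unitaryGroup_of_continuous (by fun_prop))] at h
  simp only [integral_const_mul] at h
  exact sub_eq_zero.mp h

theorem card_sq_sub_one_mul_heisenbergMoment_two (p q : Fin 2 → ι) :
    ((Fintype.card ι : ℂ) ^ 2 - 1) * heisenbergMoment μ O p q =
      Fintype.card ι * ((1 : Matrix ι ι ℂ) (p 0) (q 1) * (1 : Matrix ι ι ℂ) (p 1) (q 0)) -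
        (1 : Matrix ι ι ℂ) (p 0) (q 0) * (1 : Matrix ι ι ℂ) (p 1) (q 1) := by
  have h1 := heisenbergMoment_two_recursion μ hOO hO p q
  have hq : (q ∘ Equiv.swap 0 1) ∘ Equiv.swap 0 1 = q := by
    ext k
    simp
  have h2 : Fintype.card ι * heisenbergMoment μ O p (q ∘ Equiv.swap 0 1) +
      heisenbergMoment μ O p ((q ∘ Equiv.swap 0 1) ∘ Equiv.swap 0 1) =
      (1 : Matrix ι ι ℂ) (p 0) (q 0) * (1 : Matrix ι ι ℂ) (p 1) (q 1) :=
    heisenbergMoment_two_recursion μ hOO hO p (q ∘ Equiv.swap 0 1)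
  rw [hq] at h2
  linear_combination (Fintype.card ι : ℂ) * h1 - h2

omit hOO hO [DecidableEq ι] [MeasurableSpace (Matrix.unitaryGroup ι ℂ)]
  [BorelSpace (Matrix.unitaryGroup ι ℂ)] in
theorem eq_zero_of_card_mul_add_swap_eq_zero (hD : 4 ≤ Fintype.card ι)
    {f : (Fin 4 → ι) → ℂ} (hf : ∀ q, Fintype.card ι * f q + f (q ∘ Equiv.swap 0 1) +
      f (q ∘ Equiv.swap 0 2) + f (q ∘ Equiv.swap 0 3) = 0) : f = 0 := by
  have hD' : (4 : ℝ) ≤ Fintype.card ι := by exact_mod_cast hD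
  refine norm_le_zero_iff.mp ?_
  have h : ‖f‖ ≤ 3 / 4 * ‖f‖ := by
    refine (pi_norm_le_iff_of_nonneg (by positivity)).mpr fun q => ?_
    have hq : (Fintype.card ι : ℂ) * f q = -(f (q ∘ Equiv.swap 0 1) +
        f (q ∘ Equiv.swap 0 2) + f (q ∘ Equiv.swap 0 3)) := by
      linear_combination hf q
    have hn := congrArg norm hq
    rw [norm_mul, Complex.norm_natCast, norm_neg] at hn
    have h3 := norm_add₃_le (a := f (q ∘ Equiv.swap 0 1)) (b := f (q ∘ Equiv.swap 0 2))
      (c := f (q ∘ Equiv.swap 0 3))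
    have hle := norm_le_pi_norm f
    have h1 := hle (q ∘ Equiv.swap 0 1)
    have h2 := hle (q ∘ Equiv.swap 0 2)
    have h4 := hle (q ∘ Equiv.swap 0 3)
    nlinarith [norm_nonneg (f q)]
  linarith [norm_nonneg f]

/-- The sum over `σ` of the Weingarten coefficients times the Kronecker deltas
`∏ i, d i (σ i)`. -/
def fourMomentNumerator (D : ℂ) (d : Fin 4 → Fin 4 → ℂ) : ℂ :=
    3 * (d 0 0 * d 1 1 * d 2 2 * d 3 3 +
      d 0 0 * d 1 2 * d 2 3 * d 3 1 +
      d 0 0 * d 1 3 * d 2 1 * d 3 2 +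
      d 0 1 * d 1 2 * d 2 0 * d 3 3 +
      d 0 1 * d 1 3 * d 2 2 * d 3 0 +
      d 0 2 * d 1 0 * d 2 1 * d 3 3 +
      d 0 2 * d 1 1 * d 2 3 * d 3 0 +
      d 0 3 * d 1 0 * d 2 2 * d 3 1 +
      d 0 3 * d 1 1 * d 2 0 * d 3 2) -
    D * (d 0 0 * d 1 1 * d 2 3 * d 3 2 +
      d 0 0 * d 1 2 * d 2 1 * d 3 3 +
      d 0 0 * d 1 3 * d 2 2 * d 3 1 +
      d 0 1 * d 1 0 * d 2 2 * d 3 3 +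
      d 0 2 * d 1 1 * d 2 0 * d 3 3 +
      d 0 3 * d 1 1 * d 2 2 * d 3 0 +
      d 0 1 * d 1 2 * d 2 3 * d 3 0 +
      d 0 1 * d 1 3 * d 2 0 * d 3 2 +
      d 0 2 * d 1 0 * d 2 3 * d 3 1 +
      d 0 2 * d 1 3 * d 2 1 * d 3 0 +
      d 0 3 * d 1 0 * d 2 1 * d 3 2 +
      d 0 3 * d 1 2 * d 2 0 * d 3 1) +
    (D ^ 2 - 6) * (d 0 1 * d 1 0 * d 2 3 * d 3 2 +
      d 0 2 * d 1 3 * d 2 0 * d 3 1 +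
      d 0 3 * d 1 2 * d 2 1 * d 3 0)

omit hOO hO [MeasurableSpace (Matrix.unitaryGroup ι ℂ)] [BorelSpace (Matrix.unitaryGroup ι ℂ)] in
theorem fourMomentNumerator_recursion (D : ℂ) (d : Fin 4 → Fin 4 → ℂ) :
    D * fourMomentNumerator D d + fourMomentNumerator D (fun i j => d i (Equiv.swap 0 1 j)) +
      fourMomentNumerator D (fun i j => d i (Equiv.swap 0 2 j)) +
      fourMomentNumerator D (fun i j => d i (Equiv.swap 0 3 j)) =
    (D ^ 2 - 9) * (d 0 1 * d 1 0 * (D * (d 2 3 * d 3 2) - d 2 2 * d 3 3) +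
      d 0 2 * d 2 0 * (D * (d 1 3 * d 3 1) - d 1 1 * d 3 3) +
      d 0 3 * d 3 0 * (D * (d 1 2 * d 2 1) - d 1 1 * d 2 2)) := by
  have hs12 : (Equiv.swap (0 : Fin 4) 1) 2 = 2 := by decide
  have hs13 : (Equiv.swap (0 : Fin 4) 1) 3 = 3 := by decide
  have hs21 : (Equiv.swap (0 : Fin 4) 2) 1 = 1 := by decide
  have hs23 : (Equiv.swap (0 : Fin 4) 2) 3 = 3 := by decide
  have hs31 : (Equiv.swap (0 : Fin 4) 3) 1 = 1 := by decide
  have hs32 : (Equiv.swap (0 : Fin 4) 3) 2 = 2 := by decide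
  simp only [fourMomentNumerator, Equiv.swap_apply_left, Equiv.swap_apply_right, hs12, hs13, hs21,
    hs23, hs31, hs32]
  ring

theorem card_mul_heisenbergMoment_four (hD : 4 ≤ Fintype.card ι) (p q : Fin 4 → ι) :
    ((Fintype.card ι : ℂ) ^ 2 - 1) * ((Fintype.card ι : ℂ) ^ 2 - 9) * heisenbergMoment μ O p q =
      fourMomentNumerator (Fintype.card ι) fun i j => (1 : Matrix ι ι ℂ) (p i) (q j) := by
  refine sub_eq_zero.mp (congrFun (eq_zero_of_card_mul_add_swap_eq_zero hD
    (f := fun q => ((Fintype.card ι : ℂ) ^ 2 - 1) * ((Fintype.card ι : ℂ) ^ 2 - 9) *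
      heisenbergMoment μ O p q - fourMomentNumerator (Fintype.card ι) fun i j =>
        (1 : Matrix ι ι ℂ) (p i) (q j)) fun q => ?_) q)
  have h := heisenbergMoment_four_recursion μ hOO hO p q
  have h2 : ∀ a b i j : ι, ((Fintype.card ι : ℂ) ^ 2 - 1) * heisenbergMoment μ O ![a, b] ![i, j] =
      Fintype.card ι * ((1 : Matrix ι ι ℂ) a j * (1 : Matrix ι ι ℂ) b i) -
        (1 : Matrix ι ι ℂ) a i * (1 : Matrix ι ι ℂ) b j := fun a b i j =>
    card_sq_sub_one_mul_heisenbergMoment_two μ hOO hO ![a, b] ![i, j]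
  have key := fourMomentNumerator_recursion (Fintype.card ι)
    fun i j => (1 : Matrix ι ι ℂ) (p i) (q j)
  have hcomp : ∀ σ : Equiv.Perm (Fin 4),
      (fourMomentNumerator (Fintype.card ι) fun i j => (1 : Matrix ι ι ℂ) (p i) ((q ∘ σ) j)) =
        fourMomentNumerator (Fintype.card ι) fun i j => (1 : Matrix ι ι ℂ) (p i) (q (σ j)) :=
    fun _ => rfl
  rw [hcomp, hcomp, hcomp]
  linear_combination ((Fintype.card ι : ℂ) ^ 2 - 1) * ((Fintype.card ι : ℂ) ^ 2 - 9) * h - key +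
    ((Fintype.card ι : ℂ) ^ 2 - 9) *
      ((1 : Matrix ι ι ℂ) (p 0) (q 1) * (1 : Matrix ι ι ℂ) (p 1) (q 0) * h2 (p 2) (p 3) (q 2) (q 3) +
      (1 : Matrix ι ι ℂ) (p 0) (q 2) * (1 : Matrix ι ι ℂ) (p 2) (q 0) * h2 (p 1) (p 3) (q 1) (q 3) +
      (1 : Matrix ι ι ℂ) (p 0) (q 3) * (1 : Matrix ι ι ℂ) (p 3) (q 0) * h2 (p 1) (p 2) (q 1) (q 2))

end HaarTwirl

section Purity

variable {ιA ιB : Type*} [Fintype ιA] [Fintype ιB]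

theorem sum_fin_four_arrow {κ : Type*} [Fintype κ] (F : (Fin 4 → κ) → ℂ) :
    ∑ a, F a = ∑ i, ∑ j, ∑ k, ∑ l, F ![i, j, k, l] := by
  simp only [← (Fin.consEquiv fun _ => κ).sum_comp, Fintype.sum_prod_type, Fintype.sum_unique]
  rfl

theorem permA_values : permA 0 = 1 ∧ permA 1 = 0 ∧ permA 2 = 3 ∧ permA 3 = 2 := by
  unfold permA
  decide

theorem permB_values : permB 0 = 3 ∧ permB 1 = 2 ∧ permB 2 = 1 ∧ permB 3 = 0 := by
  unfold permB
  decide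

theorem trace_rhoA_mul_rhoA {X : Matrix (ιA × ιB) (ιA × ιB) ℂ} (hX : X.IsHermitian) :
    (rhoA X * rhoA X).trace =
      (1 / ((Fintype.card ιA : ℂ) * Fintype.card ιB)) ^ 2 *
      ∑ a : Fin 4 → ιA, ∑ b : Fin 4 → ιB, ∏ k, X (a k, b k) (a (permB k), b (permA k)) := by
  obtain ⟨hA0, hA1, hA2, hA3⟩ := permA_values
  obtain ⟨hB0, hB1, hB2, hB3⟩ := permB_values
  have hs : ∀ r s, star (X r s) = X s r := fun r s => hX.apply s r
  have hrev : ∀ F : ιA → ιA → ιA → ℂ, ∑ x, ∑ y, ∑ z, F x y z = ∑ z, ∑ y, ∑ x, F x y z := by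
    intro F
    rw [Finset.sum_comm_cycle]
    exact Finset.sum_congr rfl fun z _ => Finset.sum_comm
  simp only [Matrix.trace, Matrix.diag_apply, Matrix.mul_apply, rhoA, hs, Fintype.sum_prod_type,
    sum_fin_four_arrow, Fin.prod_univ_four, hA0, hA1, hA2, hA3, hB0, hB1, hB2, hB3]
  simp only [Matrix.cons_val]
  rw [Finset.mul_sum]
  refine Finset.sum_congr rfl fun i _ => ?_
  rw [hrev, Finset.mul_sum]
  refine Finset.sum_congr rfl fun j' _ => ?_
  rw [Finset.mul_sum]
  refine Finset.sum_congr rfl fun j _ => ?_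
  rw [Finset.mul_sum]
  refine Finset.sum_congr rfl fun i' _ => ?_
  rw [mul_mul_mul_comm, ← sq]
  congr 1
  simp only [Finset.sum_mul]
  simp only [Finset.mul_sum, mul_assoc]

theorem sum_sum_fourMomentNumerator {α β : Type*} [Fintype α] [Fintype β]
    (D : ℂ) (dA : α → Fin 4 → Fin 4 → ℂ) (dB : β → Fin 4 → Fin 4 → ℂ)
    (f g : Fin 4 → Fin 4 → Fin 4 → Fin 4 → ℂ)
    (hf : ∀ s t u v, ∑ a, dA a 0 s * dA a 1 t * dA a 2 u * dA a 3 v = f s t u v)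
    (hg : ∀ s t u v, ∑ b, dB b 0 s * dB b 1 t * dB b 2 u * dB b 3 v = g s t u v) :
    ∑ a, ∑ b, fourMomentNumerator D (fun i j => dA a i j * dB b i j) =
    3 * (f 0 1 2 3 * g 0 1 2 3 +
      f 0 2 3 1 * g 0 2 3 1 +
      f 0 3 1 2 * g 0 3 1 2 +
      f 1 2 0 3 * g 1 2 0 3 +
      f 1 3 2 0 * g 1 3 2 0 +
      f 2 0 1 3 * g 2 0 1 3 +
      f 2 1 3 0 * g 2 1 3 0 +
      f 3 0 2 1 * g 3 0 2 1 +
      f 3 1 0 2 * g 3 1 0 2) -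
    D * (f 0 1 3 2 * g 0 1 3 2 +
      f 0 2 1 3 * g 0 2 1 3 +
      f 0 3 2 1 * g 0 3 2 1 +
      f 1 0 2 3 * g 1 0 2 3 +
      f 2 1 0 3 * g 2 1 0 3 +
      f 3 1 2 0 * g 3 1 2 0 +
      f 1 2 3 0 * g 1 2 3 0 +
      f 1 3 0 2 * g 1 3 0 2 +
      f 2 0 3 1 * g 2 0 3 1 +
      f 2 3 1 0 * g 2 3 1 0 +
      f 3 0 1 2 * g 3 0 1 2 +
      f 3 2 0 1 * g 3 2 0 1) +
    (D ^ 2 - 6) * (f 1 0 3 2 * g 1 0 3 2 +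
      f 2 3 0 1 * g 2 3 0 1 +
      f 3 2 1 0 * g 3 2 1 0) := by
  have h : ∀ s t u v, ∑ a, ∑ b, (dA a 0 s * dB b 0 s) * (dA a 1 t * dB b 1 t) *
      (dA a 2 u * dB b 2 u) * (dA a 3 v * dB b 3 v) = f s t u v * g s t u v := by
    intro s t u v
    rw [← hf, ← hg, Finset.sum_mul_sum]
    refine Finset.sum_congr rfl fun a _ => Finset.sum_congr rfl fun b _ => ?_
    ring
  simp only [fourMomentNumerator, Finset.sum_add_distrib, Finset.sum_sub_distrib, ← Finset.mul_sum,
    h]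

/-- The Kronecker delta. -/
def kroneckerDelta {κ : Type*} [DecidableEq κ] (i j : κ) : ℂ :=
  (1 : Matrix κ κ ℂ) i j

theorem kroneckerDelta_self {κ : Type*} [DecidableEq κ] (i : κ) : kroneckerDelta i i = 1 :=
  Matrix.one_apply_eq i

theorem sum_kroneckerDelta_mul {κ : Type*} [Fintype κ] [DecidableEq κ] (j : κ) (f : κ → ℂ) :
    ∑ i, kroneckerDelta i j * f i = f j := by
  simp [kroneckerDelta, Matrix.one_apply]

/-- The number of quadruples in `κ` that are invariant under `![s, t, u, v]`. -/
def deltaSum (κ : Type*) [Fintype κ] [DecidableEq κ] (s t u v : Fin 4) : ℂ :=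
  ∑ a : Fin 4 → κ, kroneckerDelta (a 3) (a v) * (kroneckerDelta (a 2) (a u) *
    (kroneckerDelta (a 1) (a t) * kroneckerDelta (a 0) (a s)))

theorem deltaSum_of_one_cycles (κ : Type*) [Fintype κ] [DecidableEq κ] :
    deltaSum κ 1 2 3 0 = Fintype.card κ ^ 1 ∧ deltaSum κ 1 3 0 2 = Fintype.card κ ^ 1 ∧
    deltaSum κ 2 0 3 1 = Fintype.card κ ^ 1 ∧ deltaSum κ 2 3 1 0 = Fintype.card κ ^ 1 ∧
    deltaSum κ 3 0 1 2 = Fintype.card κ ^ 1 ∧ deltaSum κ 3 2 0 1 = Fintype.card κ ^ 1 := by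
  refine ⟨?_, ?_, ?_, ?_, ?_, ?_⟩ <;>
  simp [deltaSum, sum_fin_four_arrow, kroneckerDelta_self, sum_kroneckerDelta_mul]

theorem deltaSum_of_two_cycles (κ : Type*) [Fintype κ] [DecidableEq κ] :
    deltaSum κ 0 2 3 1 = Fintype.card κ ^ 2 ∧ deltaSum κ 0 3 1 2 = Fintype.card κ ^ 2 ∧
    deltaSum κ 1 0 3 2 = Fintype.card κ ^ 2 ∧ deltaSum κ 1 2 0 3 = Fintype.card κ ^ 2 ∧
    deltaSum κ 1 3 2 0 = Fintype.card κ ^ 2 ∧ deltaSum κ 2 0 1 3 = Fintype.card κ ^ 2 ∧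
    deltaSum κ 2 1 3 0 = Fintype.card κ ^ 2 ∧ deltaSum κ 2 3 0 1 = Fintype.card κ ^ 2 ∧
    deltaSum κ 3 0 2 1 = Fintype.card κ ^ 2 ∧ deltaSum κ 3 1 0 2 = Fintype.card κ ^ 2 ∧
    deltaSum κ 3 2 1 0 = Fintype.card κ ^ 2 := by
  refine ⟨?_, ?_, ?_, ?_, ?_, ?_, ?_, ?_, ?_, ?_, ?_⟩ <;>
  simp [deltaSum, sum_fin_four_arrow, kroneckerDelta_self, sum_kroneckerDelta_mul, pow_succ,
    ← Finset.mul_sum]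

theorem deltaSum_of_three_cycles (κ : Type*) [Fintype κ] [DecidableEq κ] :
    deltaSum κ 0 1 3 2 = Fintype.card κ ^ 3 ∧ deltaSum κ 0 2 1 3 = Fintype.card κ ^ 3 ∧
    deltaSum κ 0 3 2 1 = Fintype.card κ ^ 3 ∧ deltaSum κ 1 0 2 3 = Fintype.card κ ^ 3 ∧
    deltaSum κ 2 1 0 3 = Fintype.card κ ^ 3 ∧ deltaSum κ 3 1 2 0 = Fintype.card κ ^ 3 := by
  refine ⟨?_, ?_, ?_, ?_, ?_, ?_⟩ <;>
  simp [deltaSum, sum_fin_four_arrow, kroneckerDelta_self, sum_kroneckerDelta_mul, pow_succ,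
    ← Finset.mul_sum, mul_assoc]

theorem deltaSum_of_four_cycles (κ : Type*) [Fintype κ] [DecidableEq κ] :
    deltaSum κ 0 1 2 3 = Fintype.card κ ^ 4 := by
  simp [deltaSum, kroneckerDelta_self, pow_succ, mul_assoc]

theorem sum_fourMomentNumerator_purity [DecidableEq ιA] [DecidableEq ιB] (D : ℂ)
    (hD : D = Fintype.card ιA * Fintype.card ιB) :
    ∑ a : Fin 4 → ιA, ∑ b : Fin 4 → ιB, fourMomentNumerator D (fun k l =>
        (1 : Matrix ιA ιA ℂ) (a k) (a (permB l)) * (1 : Matrix ιB ιB ℂ) (b k) (b (permA l))) =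
      D ^ 2 * (((Fintype.card ιA : ℂ) ^ 2 + (Fintype.card ιB : ℂ) ^ 2) * (D ^ 2 - 10) -
        (D ^ 2 - 19)) := by
  obtain ⟨hA0, hA1, hA2, hA3⟩ := permA_values
  obtain ⟨hB0, hB1, hB2, hB3⟩ := permB_values
  rw [sum_sum_fourMomentNumerator D _ _ (fun s t u v => deltaSum ιA (permB s) (permB t) (permB u)
    (permB v)) (fun s t u v => deltaSum ιB (permA s) (permA t) (permA u) (permA v))
    (fun _ _ _ _ => Finset.sum_congr rfl fun _ _ => by simp only [kroneckerDelta]; ring)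
    (fun _ _ _ _ => Finset.sum_congr rfl fun _ _ => by simp only [kroneckerDelta]; ring)]
  simp only [hA0, hA1, hA2, hA3, hB0, hB1, hB2, hB3]
  simp only [deltaSum_of_one_cycles, deltaSum_of_two_cycles, deltaSum_of_three_cycles,
    deltaSum_of_four_cycles]
  rw [hD]
  ring

end Purity

theorem integral_trace_rhoA_mul_rhoA {ι ιA ιB : Type*} [Fintype ι] [DecidableEq ι] [Fintype ιA]
    [Fintype ιB] [MeasurableSpace (Matrix.unitaryGroup ι ℂ)]
    [BorelSpace (Matrix.unitaryGroup ι ℂ)] (μ : Measure (Matrix.unitaryGroup ι ℂ))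
    [IsProbabilityMeasure μ] [μ.IsMulLeftInvariant] {O : Matrix ι ι ℂ} (hOO : O * O = 1)
    (hO : O.trace = 0) (hOH : O.IsHermitian) (hcard : 4 ≤ Fintype.card ι) (e : ι ≃ ιA × ιB) :
    Integrable (fun U => (rhoA (Matrix.reindex e e (heisenberg O U)) *
      rhoA (Matrix.reindex e e (heisenberg O U))).trace) μ ∧
    ((Fintype.card ι : ℂ) ^ 2 - 1) * ((Fintype.card ι : ℂ) ^ 2 - 9) *
      ∫ U, (rhoA (Matrix.reindex e e (heisenberg O U)) *
        rhoA (Matrix.reindex e e (heisenberg O U))).trace ∂μ =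
      ((Fintype.card ιA : ℂ) ^ 2 + (Fintype.card ιB : ℂ) ^ 2) * ((Fintype.card ι : ℂ) ^ 2 - 10) -
        ((Fintype.card ι : ℂ) ^ 2 - 19) := by
  have hD : (Fintype.card ι : ℂ) = Fintype.card ιA * Fintype.card ιB := by
    rw [Fintype.card_congr e, Fintype.card_prod, Nat.cast_mul]
  have hD0 : (Fintype.card ι : ℂ) ≠ 0 := by
    rw [Nat.cast_ne_zero]
    lia
  have htr : (fun U => (rhoA (Matrix.reindex e e (heisenberg O U)) *
      rhoA (Matrix.reindex e e (heisenberg O U))).trace) = fun U =>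
      (1 / (Fintype.card ι : ℂ)) ^ 2 * ∑ a : Fin 4 → ιA, ∑ b : Fin 4 → ιB,
        ∏ k, heisenberg O U (e.symm (a k, b k)) (e.symm (a (permB k), b (permA k))) := by
    funext U
    rw [trace_rhoA_mul_rhoA (X := Matrix.reindex e e (heisenberg O U))
      ((isHermitian_heisenberg hOH U).submatrix e.symm), ← hD]
    rfl
  have hdelta : ∀ (a a' : ιA) (b b' : ιB), (1 : Matrix ι ι ℂ) (e.symm (a, b)) (e.symm (a', b')) =
      (1 : Matrix ιA ιA ℂ) a a' * (1 : Matrix ιB ιB ℂ) b b' := by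
    intro a a' b b'
    simp only [Matrix.one_apply, e.symm.injective.eq_iff, Prod.mk.injEq, ite_and, mul_ite, mul_one,
      mul_zero]
    split_ifs <;> rfl
  have hmoment : ∀ (a : Fin 4 → ιA) (b : Fin 4 → ιB),
      ((Fintype.card ι : ℂ) ^ 2 - 1) * ((Fintype.card ι : ℂ) ^ 2 - 9) *
      ∫ U, ∏ k, heisenberg O U (e.symm (a k, b k)) (e.symm (a (permB k), b (permA k))) ∂μ =
      fourMomentNumerator (Fintype.card ι) fun k l =>
        (1 : Matrix ιA ιA ℂ) (a k) (a (permB l)) * (1 : Matrix ιB ιB ℂ) (b k) (b (permA l)) := by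
    intro a b
    refine (card_mul_heisenbergMoment_four μ hOO hO hcard (fun k => e.symm (a k, b k))
      fun k => e.symm (a (permB k), b (permA k))).trans ?_
    congr 1
    funext k l
    exact hdelta _ _ _ _
  rw [htr]
  refine ⟨integrable_unitaryGroup_of_continuous (by fun_prop), ?_⟩
  rw [integral_const_mul,
    integral_finsetSum _ fun a _ => integrable_unitaryGroup_of_continuous (by fun_prop)]
  have hsum := sum_fourMomentNumerator_purity (ιA := ιA) (ιB := ιB) (Fintype.card ι) hD
  simp only [← hmoment, ← Finset.mul_sum] at hsum
  have hint : ∀ a : Fin 4 → ιA, ∫ U, ∑ b : Fin 4 → ιB, ∏ k, heisenberg O U (e.symm (a k, b k))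
      (e.symm (a (permB k), b (permA k))) ∂μ = ∑ b : Fin 4 → ιB, ∫ U, ∏ k,
        heisenberg O U (e.symm (a k, b k)) (e.symm (a (permB k), b (permA k))) ∂μ := fun a =>
    integral_finsetSum _ fun b _ => integrable_unitaryGroup_of_continuous (by fun_prop)
  simp only [hint]
  rw [mul_left_comm, hsum]
  field_simp

section PauliString

theorem pauli_mul_self (i : Fin 4) : pauli i * pauli i = 1 := by
  fin_cases i <;> ext j k <;> fin_cases j <;> fin_cases k <;>
    simp [pauli, Matrix.mul_apply, Fin.sum_univ_two]

theorem isHermitian_pauli (i : Fin 4) : (pauli i).IsHermitian := by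
  refine Matrix.IsHermitian.ext fun j k => ?_
  fin_cases i <;> fin_cases j <;> fin_cases k <;> simp [pauli]

theorem trace_pauli {i : Fin 4} (hi : i ≠ 0) : (pauli i).trace = 0 := by
  fin_cases i <;> simp_all [pauli, Matrix.trace, Fin.sum_univ_two]

variable {N : ℕ} (a : Fin N → Fin 4)

theorem PauliString_mul_self : PauliString a * PauliString a = 1 := by
  ext f g
  have h : ∀ k, ∑ x, pauli (a k) (f k) x * pauli (a k) x (g k) =
      (1 : Matrix (Fin 2) (Fin 2) ℂ) (f k) (g k) := fun k => by
    rw [← Matrix.mul_apply, pauli_mul_self]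
  simp only [Matrix.mul_apply, PauliString, ← Finset.prod_mul_distrib]
  rw [← Fintype.prod_sum fun k x => pauli (a k) (f k) x * pauli (a k) x (g k)]
  simp only [h, Matrix.one_apply, Finset.prod_ite_zero, funext_iff]
  simp

theorem isHermitian_PauliString : (PauliString a).IsHermitian := by
  refine Matrix.IsHermitian.ext fun f g => ?_
  simp only [PauliString, star_prod, (isHermitian_pauli _).apply]

theorem trace_PauliString {a} (ha : ∃ k, a k ≠ 0) : (PauliString (N := N) a).trace = 0 := by
  obtain ⟨k, hk⟩ := ha
  simp only [Matrix.trace, Matrix.diag_apply, PauliString]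
  rw [← Fintype.prod_sum fun k x => pauli (a k) x x]
  exact Finset.prod_eq_zero (Finset.mem_univ k) (trace_pauli hk)

end PauliString

/-- Haar-averaged operator purity / Page curve for
local-operator entanglement. -/
theorem haar_average_operator_purity (NA NB : ℕ) (hN : 2 ≤ NA + NB)
    (a₀ : Fin (NA + NB) → Fin 4) (h₀ : ∃ k, a₀ k ≠ 0)
    [MeasurableSpace (Matrix.unitaryGroup (Fin (NA + NB) → Fin 2) ℂ)]
    [BorelSpace (Matrix.unitaryGroup (Fin (NA + NB) → Fin 2) ℂ)]
    (μ : MeasureTheory.Measure (Matrix.unitaryGroup (Fin (NA + NB) → Fin 2) ℂ))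
    [MeasureTheory.IsProbabilityMeasure μ] [μ.Regular] [μ.IsMulLeftInvariant] :
    ∫ U, (Matrix.trace
        (rhoAq NA NB ((↑U)ᴴ * PauliString a₀ * (↑U : Matrix _ _ ℂ)) *
          rhoAq NA NB ((↑U)ᴴ * PauliString a₀ * (↑U : Matrix _ _ ℂ)))).re ∂μ =
      ((((2 : ℝ) ^ NA) ^ 4 + ((2 : ℝ) ^ (NA + NB)) ^ 2) *
            (((2 : ℝ) ^ (NA + NB)) ^ 2 - 10) -
          ((2 : ℝ) ^ NA) ^ 2 * (((2 : ℝ) ^ (NA + NB)) ^ 2 - 19)) /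
        (((2 : ℝ) ^ NA) ^ 2 * (((2 : ℝ) ^ (NA + NB)) ^ 2 - 9) *
          (((2 : ℝ) ^ (NA + NB)) ^ 2 - 1)) := by
  obtain ⟨hint, h⟩ := integral_trace_rhoA_mul_rhoA μ (PauliString_mul_self a₀)
    (trace_PauliString h₀) (isHermitian_PauliString a₀)
    (by simpa using Nat.pow_le_pow_right two_pos hN) (qubitEquiv NA NB)
  have hD : (4 : ℝ) ≤ 2 ^ (NA + NB) := by
    exact_mod_cast Nat.pow_le_pow_right two_pos hN
  have h1 : ((2 : ℝ) ^ (NA + NB)) ^ 2 - 1 ≠ 0 := by nlinarith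
  have h9 : ((2 : ℝ) ^ (NA + NB)) ^ 2 - 9 ≠ 0 := by nlinarith
  refine (integral_re hint).trans ?_
  generalize (∫ U, _ ∂μ : ℂ) = z at h ⊢
  have hz : (((((2 : ℝ) ^ (NA + NB)) ^ 2 - 1) * (((2 : ℝ) ^ (NA + NB)) ^ 2 - 9) : ℝ) : ℂ) * z =
      (((((2 : ℝ) ^ NA) ^ 2 + ((2 : ℝ) ^ NB) ^ 2) * (((2 : ℝ) ^ (NA + NB)) ^ 2 - 10) -
        (((2 : ℝ) ^ (NA + NB)) ^ 2 - 19) : ℝ) : ℂ) := by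
    push_cast
    simpa using h
  have hre := congrArg Complex.re hz
  rw [Complex.re_ofReal_mul, Complex.ofReal_re] at hre
  rw [eq_div_iff (by positivity)]
  change z.re * _ = _
  linear_combination ((2 : ℝ) ^ NA) ^ 2 * hre

end
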